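/- arXiv:2009.11083 — 2 statements merged into one kernel-verified Lean document; each statement's English description precedes it below -/
import Mathlib

section
/- Let f be holomorphic on the upper half-plane ℂ₊ = {z ∈ ℂ : Im z > 0}, let p ∈ (0,∞], and assume M := sup_{y>0} ‖f(·+iy)‖_{L^p(ℝ)} < ∞. Then the function y ↦ ‖f(·+iy)‖_{L^p(ℝ)} is (weakly) decreasing on (0,∞): for 0 < y' ≤ y one has ‖f(·+iy)‖_{L^p(ℝ)} ≤ ‖f(·+iy')‖_{L^p(ℝ)}. -/
open MeasureTheory
open scoped ENNReal

open Real Filter Topology Metric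

/-- A continuous function bounded above on the half-plane `a ≤ Im z` and satisfying the sub-mean
value inequality on discs contained in it is bounded by its supremum on the boundary line. -/
theorem le_of_submean_of_le_boundary {u : ℂ → ℝ} {a S B : ℝ} (hu : Continuous u)
    (hB : ∀ z : ℂ, a ≤ z.im → u z ≤ B) (hS : ∀ z : ℂ, z.im = a → u z ≤ S)
    (hsub : ∀ (c : ℂ) (r : ℝ), 0 < r → a ≤ c.im - r → u c ≤ circleAverage u c r)
    {z : ℂ} (hz : a ≤ z.im) : u z ≤ S := by
  set b : ℂ := ((a - 1 : ℝ) : ℂ) * Complex.I with hb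
  have hbim : b.im = a - 1 := by simp [hb]
  have hone : ∀ w : ℂ, a ≤ w.im → 1 ≤ ‖w - b‖ := fun w hw => by
    have h1 : (w - b).im = w.im - (a - 1) := by rw [Complex.sub_im, hbim]
    have h2 := Complex.im_le_norm (w - b)
    linarith
  have hlog : ∀ w : ℂ, a ≤ w.im → 0 ≤ log ‖w - b‖ := fun w hw => log_nonneg (hone w hw)
  refine le_of_forall_pos_le_add fun δ hδ => ?_
  obtain ⟨ε, hε, hεδ⟩ : ∃ ε : ℝ, 0 < ε ∧ ε * log ‖z - b‖ ≤ δ := by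
    refine ⟨δ / (1 + log ‖z - b‖), by have := hlog z hz; positivity, ?_⟩
    have := hlog z hz
    rw [div_mul_eq_mul_div, div_le_iff₀ (by positivity)]
    nlinarith
  set v : ℂ → ℝ := fun w => u w - ε * log ‖w - b‖ with hv
  have hvc : ContinuousOn v {w : ℂ | a ≤ w.im} := by
    refine hu.continuousOn.sub (continuousOn_const.mul (ContinuousOn.log (by fun_prop) ?_))
    intro w hw
    have := hone w hw
    positivity
  have hclosed : IsClosed {w : ℂ | a ≤ w.im} := isClosed_le continuous_const Complex.continuous_im
  have htend : Tendsto (fun w : ℂ => log ‖w - b‖) (cocompact ℂ) atTop :=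
    tendsto_log_atTop.comp (tendsto_norm_cocompact_atTop.comp
      (Homeomorph.subRight b).isClosedEmbedding.tendsto_cocompact)
  obtain ⟨w, hw, hmax⟩ : ∃ w ∈ {w : ℂ | a ≤ w.im}, IsMaxOn v {w : ℂ | a ≤ w.im} w := by
    refine hvc.exists_isMaxOn' hclosed (x₀ := z) hz ?_
    have h1 := htend.eventually_ge_atTop ((B - v z) / ε)
    filter_upwards [h1.filter_mono inf_le_left, mem_inf_of_right (mem_principal_self _)]
      with x hx hxa
    rw [div_le_iff₀ hε] at hx
    have := hB x hxa
    simp only [hv] at hx ⊢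
    linarith
  suffices h : v w ≤ S by
    have h1 : v z ≤ v w := hmax hz
    have h2 : u z - ε * log ‖z - b‖ ≤ S := h1.trans h
    linarith
  by_contra! hlt
  have hvu : ∀ x : ℂ, a ≤ x.im → v x ≤ u x := fun x hx => by
    have := mul_nonneg hε.le (hlog x hx)
    simp only [hv]; linarith
  have hwa : a < w.im := by
    refine lt_of_le_of_ne hw fun h => ?_
    have := hvu w hw
    have := hS w h.symm
    linarith
  set r := w.im - a with hr
  have hrpos : 0 < r := by linarith
  have him : ∀ x ∈ closedBall w |r|, a ≤ x.im := fun x hx => by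
    rw [abs_of_pos hrpos, mem_closedBall, dist_eq_norm] at hx
    have h2 := (abs_le.1 ((Complex.abs_im_le_norm (x - w)).trans hx)).1
    rw [Complex.sub_im] at h2
    linarith
  have hharm : circleAverage (fun x => log ‖x - b‖) w r = log ‖w - b‖ := by
    refine AnalyticOnNhd.circleAverage_log_norm_of_ne_zero (g := fun x => x - b)
      (fun x _ => by fun_prop) fun x hx h => ?_
    have := hone x (him x hx)
    rw [h, norm_zero] at this
    linarith
  have hsph : ∀ θ : ℝ, a ≤ (circleMap w r θ).im := fun θ =>
    him _ (sphere_subset_closedBall (circleMap_mem_sphere' w r θ))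
  have hvcirc : Continuous fun θ => v (circleMap w r θ) :=
    hvc.comp_continuous (continuous_circleMap w r) hsph
  have hlogint : CircleIntegrable (fun x => log ‖x - b‖) w r := by
    refine ContinuousOn.circleIntegrable' (ContinuousOn.log (by fun_prop) ?_)
    intro x hx
    have := hone x (him x (sphere_subset_closedBall hx))
    positivity
  have hvsub : v w ≤ circleAverage v w r := by
    have h1 : circleAverage v w r = circleAverage u w r - ε * log ‖w - b‖ := by
      have h2 : circleAverage (fun x => ε * log ‖x - b‖) w r = ε * log ‖w - b‖ := by
        have := circleAverage_fun_smul (a := ε) (f := fun x => log ‖x - b‖) (c := w) (R := r)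
        simp only [smul_eq_mul] at this
        rw [this, hharm]
      rw [← h2]
      exact circleAverage_fun_sub hu.continuousOn.circleIntegrable' (hlogint.const_mul ε)
    rw [h1]
    have := hsub w r hrpos (by linarith)
    simp only [hv]; linarith
  have hlow : v (circleMap w r (3 * π / 2)) < v w := by
    have him' : (circleMap w r (3 * π / 2)).im = a := by
      have h3 : sin (3 * π / 2) = -1 := by
        rw [show 3 * π / 2 = π / 2 + π by ring, sin_add_pi, sin_pi_div_two]
      have h4 : (circleMap w r (3 * π / 2)).im = w.im + r * sin (3 * π / 2) := by
        rw [circleMap, Complex.add_im, Complex.im_ofReal_mul, Complex.exp_ofReal_mul_I_im]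
      rw [h4, h3]; linarith
    exact ((hvu _ him'.ge).trans (hS _ him')).trans_lt hlt
  have hint := intervalIntegral.integral_lt_integral_of_continuousOn_of_le_of_exists_lt
    (f := fun θ => v (circleMap w r θ)) (g := fun _ => v w) two_pi_pos hvcirc.continuousOn
    continuousOn_const (fun θ _ => hmax (hsph θ))
    ⟨3 * π / 2, ⟨by positivity, by linarith [pi_pos]⟩, hlow⟩
  rw [intervalIntegral.integral_const, smul_eq_mul, sub_zero] at hint
  rw [circleAverage_def, smul_eq_mul, inv_mul_eq_div, le_div_iff₀ two_pi_pos] at hvsub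
  linarith

/-- The sub-mean value inequality for `‖f‖ ^ q`, with `f` analytic. -/
theorem norm_rpow_le_circleAverage {f : ℂ → ℂ} {c : ℂ} {r q : ℝ} (hq : 0 < q)
    (hr : 0 < r) (hf : AnalyticOnNhd ℂ f (closedBall c r)) :
    ‖f c‖ ^ q ≤ circleAverage (fun z => ‖f z‖ ^ q) c r := by
  have hf' : AnalyticOnNhd ℂ f (closedBall c |r|) := by rwa [abs_of_pos hr]
  by_cases h0 : f c = 0
  · rw [h0, norm_zero, zero_rpow hq.ne']
    exact circleAverage_nonneg_of_nonneg fun x _ => by positivity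
  have hA : 0 < ‖f c‖ := norm_pos_iff.2 h0
  set A := ‖f c‖ with hAdef
  have hlogint : CircleIntegrable (fun z => log ‖f z‖) c r :=
    (hf'.mono sphere_subset_closedBall).meromorphicOn.circleIntegrable_log_norm
  have hlog : log A ≤ circleAverage (fun z => log ‖f z‖) c r := by
    rw [hf'.circleAverage_log_norm hr.ne' h0, le_add_iff_nonneg_left]
    refine finsum_nonneg fun x => ?_
    by_cases hx : x ∈ closedBall c |r|
    · refine mul_nonneg (by exact_mod_cast MeromorphicOn.AnalyticOnNhd.divisor_nonneg hf' x) ?_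
      rcases eq_or_ne c x with rfl | hne
      · simp
      · have hpos : 0 < ‖c - x‖ := norm_pos_iff.2 (sub_ne_zero.2 hne)
        refine log_nonneg ?_
        rw [← div_eq_mul_inv, one_le_div hpos, ← dist_eq_norm, dist_comm]
        simpa [abs_of_pos hr] using hx
    · rw [Function.locallyFinsuppWithin.apply_eq_zero_of_notMem _ hx]
      simp
  set g : ℂ → ℝ := fun z => A ^ q * (1 + q * (log ‖f z‖ - log A)) with hg
  have hdint : CircleIntegrable (fun z => q * (log ‖f z‖ - log A)) c r :=
    (hlogint.sub (circleIntegrable_const (log A) c r)).const_mul q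
  have hgint : CircleIntegrable g c r :=
    ((circleIntegrable_const (1 : ℝ) c r).add hdint).const_mul (A ^ q)
  have hgavg : circleAverage g c r
      = A ^ q * (1 + q * (circleAverage (fun z => log ‖f z‖) c r - log A)) := by
    have h1 : circleAverage (fun z => log ‖f z‖ - log A) c r
        = circleAverage (fun z => log ‖f z‖) c r - log A := by
      rw [circleAverage_fun_sub hlogint (circleIntegrable_const (log A) c r), circleAverage_const]
    have h2 := circleAverage_fun_smul (a := q) (f := fun z => log ‖f z‖ - log A) (c := c) (R := r)
    have h3 := circleAverage_fun_smul (a := A ^ q)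
      (f := fun z => 1 + q * (log ‖f z‖ - log A)) (c := c) (R := r)
    simp only [smul_eq_mul] at h2 h3
    rw [hg, h3, circleAverage_fun_add (circleIntegrable_const (1 : ℝ) c r) hdint, h2, h1,
      circleAverage_const]
  have hle : circleAverage g c r ≤ circleAverage (fun z => ‖f z‖ ^ q) c r := by
    have hfc : ContinuousOn (fun z => ‖f z‖ ^ q) (sphere c |r|) :=
      ((hf'.continuousOn.mono sphere_subset_closedBall).norm).rpow_const
        fun _ _ => Or.inr hq.le
    have hne : f ⁻¹' {0}ᶜ ∈ codiscreteWithin (sphere c |r|) :=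
      codiscreteWithin_mono sphere_subset_closedBall
        (hf'.preimage_zero_mem_codiscreteWithin h0 (by simp)
          ((convex_closedBall c |r|).isConnected ⟨c, by simp⟩))
    have hcongr : (fun z => ‖f z‖ ^ q) =ᶠ[codiscreteWithin (sphere c |r|)]
        fun z => max (g z) (‖f z‖ ^ q) := by
      filter_upwards [hne] with z hz
      have hfz : 0 < ‖f z‖ := norm_pos_iff.2 hz
      refine (max_eq_right ?_).symm
      have h1 : ‖f z‖ ^ q = A ^ q * exp (q * (log ‖f z‖ - log A)) := by
        rw [rpow_def_of_pos hfz, rpow_def_of_pos hA, ← exp_add]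
        ring_nf
      rw [h1, hg]
      refine mul_le_mul_of_nonneg_left ?_ (by positivity)
      linarith [add_one_le_exp (q * (log ‖f z‖ - log A))]
    rw [circleAverage_congr_codiscreteWithin hcongr hr.ne']
    exact circleAverage_mono hgint
      (hfc.circleIntegrable'.congr_codiscreteWithin hcongr) fun z _ => le_max_left _ _
  refine le_trans ?_ hle
  rw [hgavg]
  refine le_mul_of_one_le_right (by positivity) ?_
  have := mul_nonneg hq.le (sub_nonneg.2 hlog)
  linarith

/-- The integral of a translate of `g` along a horizontal segment inherits the sub-mean value
inequality from `g`. -/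
theorem intervalIntegral_le_circleAverage {g : ℂ → ℝ} (hg : Continuous g) {a R r : ℝ} {c : ℂ}
    (hR : 0 ≤ R) (hr : 0 < r) (hc : a ≤ c.im - r)
    (hsub : ∀ (c : ℂ) (r : ℝ), 0 < r → a ≤ c.im - r → g c ≤ circleAverage g c r) :
    ∫ t in (-R)..R, g (c + t) ≤ circleAverage (fun z => ∫ t in (-R)..R, g (z + t)) c r := by
  have hcont : Continuous fun x : ℝ × ℝ => g (circleMap c r x.1 + x.2) := by fun_prop
  have hswap : circleAverage (fun z => ∫ t in (-R)..R, g (z + t)) c r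
      = ∫ t in (-R)..R, circleAverage g (c + t) r := by
    simp only [circleAverage_def, smul_eq_mul]
    rw [intervalIntegral.integral_const_mul,
      intervalIntegral_intervalIntegral_swap (F := fun θ t => g (circleMap c r θ + t))]
    · congr 1
      refine intervalIntegral.integral_congr fun t _ => ?_
      refine intervalIntegral.integral_congr fun θ _ => ?_
      simp only [circleMap]
      congr 1
      ring
    · exact (hcont.continuousOn.integrableOn_compact
        (isCompact_uIcc.prod isCompact_uIcc)).mono_set
          (Set.prod_mono Set.uIoc_subset_uIcc Set.uIoc_subset_uIcc)
  have hcont' : Continuous fun t : ℝ => circleAverage g (c + t) r := by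
    simp only [circleAverage_def, circleMap]
    fun_prop
  rw [hswap]
  refine intervalIntegral.integral_mono_on (by linarith)
    (Continuous.intervalIntegrable (by fun_prop) _ _) (hcont'.intervalIntegrable _ _) fun t _ => ?_
  exact hsub _ r hr (by simpa using hc)

/-- Integrals of a nonnegative sub-mean value function along horizontal lines of a half-plane are
at most its integral along the boundary line, provided that they are bounded. -/
theorem lintegral_ofReal_le_of_submean {g : ℂ → ℝ} (hg : Continuous g) (hg0 : ∀ z, 0 ≤ g z)
    {a : ℝ} {C : ℝ≥0∞} (hC : C ≠ ⊤)
    (hsub : ∀ (c : ℂ) (r : ℝ), 0 < r → a ≤ c.im - r → g c ≤ circleAverage g c r)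
    (hbound : ∀ y : ℝ, a ≤ y → ∫⁻ x : ℝ, ENNReal.ofReal (g (x + y * Complex.I)) ≤ C)
    {y : ℝ} (hy : a ≤ y) :
    ∫⁻ x : ℝ, ENNReal.ofReal (g (x + y * Complex.I)) ≤
      ∫⁻ x : ℝ, ENNReal.ofReal (g (x + a * Complex.I)) := by
  have hseg : ∀ (R : ℝ) (z : ℂ), 0 ≤ R → ENNReal.ofReal (∫ t in (-R)..R, g (z + t))
      = ∫⁻ t in Set.Ioc (-R) R, ENNReal.ofReal (g (z + t)) := fun R z hR => by
    rw [intervalIntegral.integral_of_le (by linarith)]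
    exact ofReal_integral_eq_lintegral_ofReal
      (Continuous.integrableOn_Ioc (by fun_prop)) (Eventually.of_forall fun t => hg0 _)
  have htrans : ∀ z : ℂ, ∫⁻ t : ℝ, ENNReal.ofReal (g (z + t))
      = ∫⁻ t : ℝ, ENNReal.ofReal (g (t + z.im * Complex.I)) := fun z => by
    rw [← lintegral_add_left_eq_self
      (fun t : ℝ => ENNReal.ofReal (g (t + z.im * Complex.I))) z.re]
    refine lintegral_congr fun t => ?_
    congr 2
    nth_rewrite 1 [← Complex.re_add_im z]
    push_cast
    ring
  have hle : ∀ (R : ℝ) (z : ℂ), 0 ≤ R → a ≤ z.im → ∫ t in (-R)..R, g (z + t)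
      ≤ (∫⁻ t : ℝ, ENNReal.ofReal (g (t + z.im * Complex.I))).toReal := fun R z hR hz => by
    rw [← ENNReal.ofReal_le_iff_le_toReal ((hbound _ hz).trans_lt hC.lt_top).ne, hseg R z hR,
      ← htrans]
    exact setLIntegral_le_lintegral _ _
  have key : ∀ R : ℝ, 0 ≤ R → ∫⁻ x in Set.Ioc (-R) R, ENNReal.ofReal (g (x + y * Complex.I))
      ≤ ∫⁻ x : ℝ, ENNReal.ofReal (g (x + a * Complex.I)) := fun R hR => by
    have hmax := le_of_submean_of_le_boundary (u := fun z => ∫ t in (-R)..R, g (z + t)) (a := a)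
      (S := (∫⁻ x : ℝ, ENNReal.ofReal (g (x + a * Complex.I))).toReal) (B := C.toReal)
      (by fun_prop)
      (fun z hz => (hle R z hR hz).trans (ENNReal.toReal_mono hC (hbound _ hz)))
      (fun z hz => (hle R z hR hz.ge).trans (by rw [hz]))
      (fun c r hr hc => intervalIntegral_le_circleAverage hg hR hr hc hsub)
      (z := y * Complex.I) (by simpa using hy)
    rw [← ENNReal.ofReal_le_iff_le_toReal ((hbound _ le_rfl).trans_lt hC.lt_top).ne,
      hseg R _ hR] at hmax
    simpa only [add_comm] using hmax
  have hcover : AECover volume atTop fun n : ℕ => Set.Ioc (-(n : ℝ)) (n : ℝ) :=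
    aecover_Ioc (tendsto_neg_atTop_atBot.comp tendsto_natCast_atTop_atTop)
      tendsto_natCast_atTop_atTop
  have hmeas : Measurable fun x : ℝ => ENNReal.ofReal (g (x + y * Complex.I)) := by
    have : Continuous fun x : ℝ => g (x + y * Complex.I) := by fun_prop
    exact this.measurable.ennreal_ofReal
  exact le_of_tendsto' (hcover.lintegral_tendsto_of_countably_generated hmeas.aemeasurable)
    fun n => key n n.cast_nonneg

/-- If `f` is holomorphic on the upper half-plane and
`sup_{y>0} ‖f(·+iy)‖_{L^p(ℝ)} < ∞` for some `p ∈ (0,∞]`, then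
`y ↦ ‖f(·+iy)‖_{L^p(ℝ)}` is decreasing on `(0,∞)`. -/
theorem stmt_8 (f : ℂ → ℂ)
    (hf : DifferentiableOn ℂ f {z : ℂ | 0 < z.im})
    (p : ℝ≥0∞) (hp : 0 < p)
    (M : ℝ≥0∞) (hM : M < ⊤)
    (hbound : ∀ y : ℝ, 0 < y →
      eLpNorm (fun x : ℝ => f (↑x + ↑y * Complex.I)) p volume ≤ M) :
    ∀ y y' : ℝ, 0 < y' → y' ≤ y →
      eLpNorm (fun x : ℝ => f (↑x + ↑y * Complex.I)) p volume ≤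
        eLpNorm (fun x : ℝ => f (↑x + ↑y' * Complex.I)) p volume := by
  intro y a ha hay
  set F : ℂ → ℂ := fun z => f (z.re + (max z.im a : ℝ) * Complex.I) with hF
  have hFf : ∀ z : ℂ, a ≤ z.im → F z = f z := fun z hz => by
    simp only [hF, max_eq_left hz, Complex.re_add_im]
  have hFline : ∀ (x t : ℝ), a ≤ t → F (x + t * Complex.I) = f (x + t * Complex.I) :=
    fun x t ht => hFf _ (by simpa using ht)
  have hFc : Continuous F := hf.continuousOn.comp_continuous (by fun_prop) fun z => by
    simp [ha]
  have hopen : IsOpen {z : ℂ | 0 < z.im} := isOpen_lt continuous_const Complex.continuous_im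
  have hsub : ∀ q : ℝ, 0 < q → ∀ (c : ℂ) (r : ℝ), 0 < r → a ≤ c.im - r →
      ‖F c‖ ^ q ≤ circleAverage (fun z => ‖F z‖ ^ q) c r := fun q hq c r hr hc => by
    have him : ∀ x ∈ closedBall c r, a ≤ x.im := fun x hx => by
      rw [mem_closedBall, dist_eq_norm] at hx
      have h2 := (abs_le.1 ((Complex.abs_im_le_norm (x - c)).trans hx)).1
      rw [Complex.sub_im] at h2
      linarith
    have hcongr : circleAverage (fun z => ‖F z‖ ^ q) c r
        = circleAverage (fun z => ‖f z‖ ^ q) c r :=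
      circleAverage_congr_sphere fun x hx => by
        rw [abs_of_pos hr] at hx
        simp only [hFf x (him x (sphere_subset_closedBall hx))]
    rw [hcongr, hFf c (by linarith)]
    exact norm_rpow_le_circleAverage hq hr
      ((hf.analyticOnNhd hopen).mono fun x hx => ha.trans_le (him x hx))
  have hlinec : ∀ t : ℝ, Continuous fun x : ℝ => F (x + t * Complex.I) := fun t => by fun_prop
  have hFn : ∀ t : ℝ, a ≤ t → eLpNorm (fun x : ℝ => f (x + t * Complex.I)) p volume
      = eLpNorm (fun x : ℝ => F (x + t * Complex.I)) p volume := fun t ht => by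
    simp only [hFline _ t ht]
  have hboundF : ∀ t : ℝ, a ≤ t →
      eLpNorm (fun x : ℝ => F (x + t * Complex.I)) p volume ≤ M := fun t ht => by
    rw [← hFn t ht]
    exact hbound t (ha.trans_le ht)
  rw [hFn y hay, hFn a le_rfl]
  rcases eq_or_ne p ⊤ with rfl | hpt
  · simp only [eLpNorm_exponent_top] at hboundF ⊢
    have hpt : ∀ t : ℝ, a ≤ t → ∀ x : ℝ, ‖F (x + t * Complex.I)‖ ≤
        (eLpNormEssSup (fun x : ℝ => F (x + t * Complex.I)) volume).toReal := fun t ht x => by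
      have hd := Measure.dense_of_ae
        (ae_le_eLpNormEssSup (f := fun x : ℝ => F (x + t * Complex.I)) (μ := volume))
      have hcl : IsClosed {x : ℝ | ‖F (x + t * Complex.I)‖ₑ ≤
          eLpNormEssSup (fun x : ℝ => F (x + t * Complex.I)) volume} :=
        isClosed_le (hlinec t).enorm continuous_const
      have hx : x ∈ {x : ℝ | ‖F (x + t * Complex.I)‖ₑ ≤
          eLpNormEssSup (fun x : ℝ => F (x + t * Complex.I)) volume} := by
        rw [← hcl.closure_eq, hd.closure_eq]
        trivial
      rw [← ENNReal.ofReal_le_iff_le_toReal ((hboundF t ht).trans_lt hM).ne, ofReal_norm]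
      exact hx
    have hpt' : ∀ z : ℂ, a ≤ z.im → ‖F z‖ ≤
        (eLpNormEssSup (fun x : ℝ => F (x + z.im * Complex.I)) volume).toReal := fun z hz => by
      simpa only [Complex.re_add_im] using hpt z.im hz z.re
    refine eLpNormEssSup_le_of_ae_enorm_bound (Eventually.of_forall fun x => ?_)
    rw [← ofReal_norm, ENNReal.ofReal_le_iff_le_toReal ((hboundF a le_rfl).trans_lt hM).ne]
    refine le_of_submean_of_le_boundary (u := fun z => ‖F z‖) (a := a) (B := M.toReal) hFc.norm
      (fun z hz => (hpt' z hz).trans (ENNReal.toReal_mono hM.ne (hboundF _ hz)))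
      (fun z hz => (hpt' z hz.ge).trans (by rw [hz]))
      (fun c r hr hc => by simpa only [rpow_one] using hsub 1 one_pos c r hr hc)
      (z := x + y * Complex.I) (by simpa using hay)
  · have hq : 0 < p.toReal := ENNReal.toReal_pos hp.ne' hpt
    have hpow : ∀ z : ℂ, ‖F z‖ₑ ^ p.toReal = ENNReal.ofReal (‖F z‖ ^ p.toReal) := fun z => by
      rw [← ofReal_norm, ENNReal.ofReal_rpow_of_nonneg (norm_nonneg _) hq.le]
    simp only [eLpNorm_eq_lintegral_rpow_enorm_toReal hp.ne' hpt, hpow] at hboundF ⊢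
    refine ENNReal.rpow_le_rpow ?_ (by positivity)
    refine lintegral_ofReal_le_of_submean (g := fun z => ‖F z‖ ^ p.toReal) (C := M ^ p.toReal)
      (hFc.norm.rpow_const fun _ => Or.inr hq.le) (fun z => by positivity)
      (ENNReal.rpow_ne_top_of_nonneg hq.le hM.ne) (hsub _ hq) (fun t ht => ?_) hay
    have := hboundF t ht
    rwa [one_div, ENNReal.rpow_inv_le_iff hq] at this
end

section
/- Let X and Y be locally compact Hausdorff spaces and μ, ν diffuse (atomless) Radon measures on X and Y respectively. Let p, q ∈ (0,∞) with min(p,q) < 1. Then every continuous linear functional on the mixed-norm space L^{p,q}(μ,ν) is zero, i.e. L^{p,q}(μ,ν)' = {0}. -/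
open MeasureTheory Filter
open scoped ENNReal

/-- The mixed `(p,q)`-norm of `f : X × Y → ℂ`. -/
noncomputable def mixedNorm {X Y : Type*} [MeasurableSpace X] [MeasurableSpace Y]
    (p q : ℝ≥0∞) (μ : Measure X) (ν : Measure Y) (f : X × Y → ℂ) : ℝ≥0∞ :=
  if q = ∞ then essSup (fun y => eLpNorm (fun x => f (x, y)) p μ) ν
  else (∫⁻ y, (eLpNorm (fun x => f (x, y)) p μ) ^ q.toReal ∂ν) ^ (1 / q.toReal)

namespace mixedNorm

lemma eq_lintegral {X Y : Type*} [MeasurableSpace X] [MeasurableSpace Y]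
    {p q : ℝ≥0∞} (hp : 0 < p) (hpf : p ≠ ⊤) (hqf : q ≠ ⊤)
    (μ : Measure X) (ν : Measure Y) (f : X × Y → ℂ) :
    mixedNorm p q μ ν f =
      (∫⁻ y, (∫⁻ x, ‖f (x, y)‖ₑ ^ p.toReal ∂μ) ^ (q.toReal / p.toReal) ∂ν) ^ (1 / q.toReal) := by
  simp only [mixedNorm, if_neg hqf, eLpNorm_eq_lintegral_rpow_enorm_toReal hp.ne' hpf,
    ← ENNReal.rpow_mul, one_div_mul_eq_div]

lemma mono {X Y : Type*} [MeasurableSpace X] [MeasurableSpace Y]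
    {p q : ℝ≥0∞} (hqf : q ≠ ⊤) (μ : Measure X) (ν : Measure Y) {f g : X × Y → ℂ}
    (h : ∀ z, ‖f z‖ₑ ≤ ‖g z‖ₑ) : mixedNorm p q μ ν f ≤ mixedNorm p q μ ν g := by
  simp only [mixedNorm, if_neg hqf]
  gcongr with y
  exact eLpNorm_mono_enorm fun x => h (x, y)

lemma congr_ae {X Y : Type*} [MeasurableSpace X] [MeasurableSpace Y]
    {p q : ℝ≥0∞} (hqf : q ≠ ⊤) (μ : Measure X) (ν : Measure Y) [SFinite μ] [SFinite ν]
    {f g : X × Y → ℂ} (h : f =ᵐ[μ.prod ν] g) : mixedNorm p q μ ν f = mixedNorm p q μ ν g := by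
  have h' : ∀ᵐ y ∂ν, ∀ᵐ x ∂μ, f (x, y) = g (x, y) := by
    refine Measure.ae_ae_of_ae_prod (p := fun z : Y × X => f z.swap = g z.swap) ?_
    exact Measure.measurePreserving_swap.quasiMeasurePreserving.ae h
  simp only [mixedNorm, if_neg hqf]
  congr 1
  refine lintegral_congr_ae ?_
  filter_upwards [h'] with y hy
  rw [eLpNorm_congr_ae hy]

lemma const_smul {X Y : Type*} [MeasurableSpace X] [MeasurableSpace Y]
    {p q : ℝ≥0∞} (hq : 0 < q) (hqf : q ≠ ⊤) (μ : Measure X) (ν : Measure Y)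
    (c : ℂ) (f : X × Y → ℂ) :
    mixedNorm p q μ ν (c • f) = ‖c‖ₑ * mixedNorm p q μ ν f := by
  have hq' : 0 < q.toReal := ENNReal.toReal_pos hq.ne' hqf
  have h (y : Y) : eLpNorm (fun x => (c • f) (x, y)) p μ
      = ‖c‖ₑ * eLpNorm (fun x => f (x, y)) p μ :=
    eLpNorm_const_smul c (fun x => f (x, y)) p μ
  simp only [mixedNorm, if_neg hqf, h, ENNReal.mul_rpow_of_nonneg _ _ hq'.le]
  rw [lintegral_const_mul' _ _ (ENNReal.rpow_ne_top_of_nonneg hq'.le enorm_ne_top),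
    ENNReal.mul_rpow_of_nonneg _ _ (by positivity), ← ENNReal.rpow_mul,
    mul_one_div_cancel hq'.ne', ENNReal.rpow_one]

/-- A function bounded by `M` and supported in the rectangle `A ×ˢ B`. -/
lemma le_of_bounded_of_support_subset {X Y : Type*} [MeasurableSpace X] [MeasurableSpace Y]
    {p q : ℝ≥0∞} (hp : 0 < p) (hpf : p ≠ ⊤) (hq : 0 < q) (hqf : q ≠ ⊤)
    (μ : Measure X) (ν : Measure Y) {f : X × Y → ℂ} {M : ℝ≥0∞}
    {A : Set X} {B : Set Y} (hA : MeasurableSet A) (hB : MeasurableSet B)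
    (hM : ∀ z, ‖f z‖ₑ ≤ M) (hf : ∀ z, z ∉ A ×ˢ B → f z = 0) :
    mixedNorm p q μ ν f ≤ M * μ A ^ (1 / p.toReal) * ν B ^ (1 / q.toReal) := by
  have hp' : 0 < p.toReal := ENNReal.toReal_pos hp.ne' hpf
  have hq' : 0 < q.toReal := ENNReal.toReal_pos hq.ne' hqf
  have inner (y : Y) : (∫⁻ x, ‖f (x, y)‖ₑ ^ p.toReal ∂μ)
      ≤ B.indicator (fun _ => M ^ p.toReal * μ A) y := by
    by_cases hy : y ∈ B
    · rw [Set.indicator_of_mem hy, ← lintegral_indicator_const hA]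
      refine lintegral_mono fun x => ?_
      by_cases hx : x ∈ A
      · simp only [Set.indicator_of_mem hx]
        gcongr
        exact hM _
      · simp [hf (x, y) (by simp [hx]), hp']
    · simp [hf (_, y) (by simp [hy]), hp']
  rw [eq_lintegral hp hpf hqf]
  calc _ ≤ (∫⁻ y, B.indicator (fun _ => (M ^ p.toReal * μ A) ^ (q.toReal / p.toReal)) y ∂ν)
        ^ (1 / q.toReal) := by
        gcongr with y
        refine (ENNReal.rpow_le_rpow (inner y) (by positivity)).trans ?_
        by_cases hy : y ∈ B
        · simp [hy]
        · simp [hy, div_pos hq' hp']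
    _ = _ := by
        rw [lintegral_indicator_const hB, ENNReal.mul_rpow_of_nonneg _ _ (by positivity),
          ← ENNReal.rpow_mul, ENNReal.mul_rpow_of_nonneg _ _ (by positivity), ← ENNReal.rpow_mul]
        congr 2
        · rw [show p.toReal * (q.toReal / p.toReal * (1 / q.toReal)) = 1 by field_simp,
            ENNReal.rpow_one]
        · congr 1
          field_simp

/-- Dominated convergence for the mixed norm of restrictions to sets that eventually leave
every point. -/
lemma tendsto_indicator_zero {X Y : Type*} [MeasurableSpace X] [MeasurableSpace Y]
    {p q : ℝ≥0∞} (hp : 0 < p) (hpf : p ≠ ⊤) (hq : 0 < q) (hqf : q ≠ ⊤)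
    (μ : Measure X) (ν : Measure Y) [SFinite μ] [SFinite ν] {f : X × Y → ℂ} (hf : Measurable f)
    (hfin : mixedNorm p q μ ν f < ⊤) {D : ℕ → Set (X × Y)} (hD : ∀ n, MeasurableSet (D n))
    (hD0 : ∀ z, ∀ᶠ n in atTop, z ∉ D n) :
    Tendsto (fun n => mixedNorm p q μ ν ((D n).indicator f)) atTop (nhds 0) := by
  have hp' : 0 < p.toReal := ENNReal.toReal_pos hp.ne' hpf
  have hq' : 0 < q.toReal := ENNReal.toReal_pos hq.ne' hqf
  have hqp : 0 < q.toReal / p.toReal := by positivity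
  have hmeas (g : X × Y → ℂ) (hg : Measurable g) :
      Measurable fun y => (∫⁻ x, ‖g (x, y)‖ₑ ^ p.toReal ∂μ) ^ (q.toReal / p.toReal) :=
    ((hg.enorm.pow_const p.toReal).lintegral_prod_left').pow_const _
  have hle (n : ℕ) (z : X × Y) : ‖(D n).indicator f z‖ₑ ≤ ‖f z‖ₑ :=
    enorm_indicator_le_enorm_self f z
  simp only [eq_lintegral hp hpf hqf] at hfin ⊢
  have hfin' : ∫⁻ y, (∫⁻ x, ‖f (x, y)‖ₑ ^ p.toReal ∂μ) ^ (q.toReal / p.toReal) ∂ν ≠ ⊤ := by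
    intro h
    rw [h, ENNReal.top_rpow_of_pos (by positivity)] at hfin
    exact hfin.ne rfl
  have outer : Tendsto (fun n => ∫⁻ y, (∫⁻ x, ‖(D n).indicator f (x, y)‖ₑ ^ p.toReal ∂μ)
      ^ (q.toReal / p.toReal) ∂ν) atTop (nhds (∫⁻ _, 0 ∂ν)) := by
    refine tendsto_lintegral_of_dominated_convergence _
      (fun n => hmeas _ (hf.indicator (hD n))) (fun n => ?_) hfin' ?_
    · refine Eventually.of_forall fun y => ?_
      dsimp only
      gcongr with x
      exact hle n _
    · filter_upwards [ae_lt_top (hmeas f hf) hfin'] with y hy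
      have hy' : ∫⁻ x, ‖f (x, y)‖ₑ ^ p.toReal ∂μ ≠ ⊤ := by
        intro h
        rw [h, ENNReal.top_rpow_of_pos hqp] at hy
        exact hy.ne rfl
      have inner : Tendsto (fun n => ∫⁻ x, ‖(D n).indicator f (x, y)‖ₑ ^ p.toReal ∂μ)
          atTop (nhds (∫⁻ _, 0 ∂μ)) := by
        refine tendsto_lintegral_of_dominated_convergence _
          (fun n => (((hf.indicator (hD n)).comp measurable_prodMk_right).enorm.pow_const _))
          (fun n => ?_) hy' ?_
        · refine Eventually.of_forall fun x => ?_
          dsimp only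
          gcongr
          exact hle n _
        · refine Eventually.of_forall fun x => tendsto_const_nhds.congr' ?_
          filter_upwards [hD0 (x, y)] with n hn
          simp [hn, hp']
      rw [lintegral_zero] at inner
      simpa [hqp] using inner.ennrpow_const (q.toReal / p.toReal)
  rw [lintegral_zero] at outer
  simpa [hq'] using outer.ennrpow_const (1 / q.toReal)

end mixedNorm

/-- A subadditive set function dominated by a power `s > 1` of a diffuse regular measure vanishes
on sets of finite measure. -/
lemma eq_zero_of_le_measure_rpow {X : Type*} [TopologicalSpace X] [T2Space X]
    [MeasurableSpace X] [BorelSpace X] (μ : Measure X) [μ.Regular] (hμ : ∀ x : X, μ {x} = 0)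
    (m : Set X → ℝ≥0∞) (C : ℝ≥0∞) (hC : C ≠ ⊤) {s : ℝ} (hs : 1 < s)
    (hm : ∀ A, MeasurableSet A → m A ≤ C * μ A ^ s)
    (hsub : ∀ A B, MeasurableSet A → MeasurableSet B → Disjoint A B → m (A ∪ B) ≤ m A + m B)
    {A : Set X} (hA : MeasurableSet A) (hAf : μ A ≠ ⊤) : m A = 0 := by
  have key (ε : ℝ≥0∞) (hε : 0 < ε) : m A ≤ C * ε ^ (s - 1) * μ A := by
    have small (B : Set X) (hB : MeasurableSet B) (hBε : μ B ≤ ε) :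
        m B ≤ C * ε ^ (s - 1) * μ B := by
      refine (hm B hB).trans ?_
      rw [mul_assoc]
      gcongr
      calc μ B ^ s = μ B ^ (s - 1) * μ B ^ (1 : ℝ) := by
            rw [← ENNReal.rpow_add_of_nonneg _ _ (by linarith) zero_le_one, sub_add_cancel]
        _ ≤ ε ^ (s - 1) * μ B := by
            rw [ENNReal.rpow_one]
            gcongr
    have union (B₁ B₂ : Set X) (h₁ : MeasurableSet B₁) (h₂ : MeasurableSet B₂)
        (hd : Disjoint B₁ B₂) (hB₁ : m B₁ ≤ C * ε ^ (s - 1) * μ B₁)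
        (hB₂ : m B₂ ≤ C * ε ^ (s - 1) * μ B₂) :
        m (B₁ ∪ B₂) ≤ C * ε ^ (s - 1) * μ (B₁ ∪ B₂) := by
      rw [measure_union hd h₂, mul_add]
      exact (hsub _ _ h₁ h₂ hd).trans (add_le_add hB₁ hB₂)
    have compact (K : Set X) (hK : IsCompact K) : ∃ T, MeasurableSet T ∧ K ⊆ T ∧
        ∀ B, MeasurableSet B → B ⊆ T → m B ≤ C * ε ^ (s - 1) * μ B := by
      refine hK.induction_on ?_ ?_ ?_ ?_
      · refine ⟨∅, .empty, subset_rfl, fun B hB hB0 => small B hB ?_⟩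
        simp [Set.subset_empty_iff.mp hB0]
      · rintro _ _ hst ⟨T, hT, hsT, h⟩
        exact ⟨T, hT, hst.trans hsT, h⟩
      · rintro _ _ ⟨T₁, hT₁, hs₁, h₁⟩ ⟨T₂, hT₂, hs₂, h₂⟩
        refine ⟨T₁ ∪ T₂, hT₁.union hT₂, Set.union_subset_union hs₁ hs₂, fun B hB hBT => ?_⟩
        rw [← Set.inter_union_sdiff B T₁]
        exact union _ _ (hB.inter hT₁) (hB.diff hT₁) Set.disjoint_sdiff_inter.symm
          (h₁ _ (hB.inter hT₁) Set.inter_subset_right)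
          (h₂ _ (hB.diff hT₁) (Set.sdiff_subset_iff.mpr hBT))
      · intro x _
        obtain ⟨U, hxU, hU, hUε⟩ := Set.exists_isOpen_lt_of_lt {x} ε (by rwa [hμ x])
        exact ⟨U, mem_nhdsWithin_of_mem_nhds (hU.mem_nhds (hxU rfl)), U, hU.measurableSet,
          subset_rfl, fun B hB hBU => small B hB ((measure_mono hBU).trans hUε.le)⟩
    obtain ⟨K, hKA, hK, hKε⟩ := hA.exists_isCompact_sdiff_lt hAf hε.ne'
    obtain ⟨T, -, hKT, hT⟩ := compact K hK
    rw [← Set.union_sdiff_cancel hKA]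
    exact union _ _ hK.measurableSet (hA.diff hK.measurableSet) Set.disjoint_sdiff_right
      (hT K hK.measurableSet hKT) (small _ (hA.diff hK.measurableSet) hKε.le)
  have lim : Tendsto (fun ε : ℝ≥0∞ => C * ε ^ (s - 1) * μ A) (nhdsWithin 0 (Set.Ioi 0))
      (nhds (C * 0 * μ A)) := by
    have h : Tendsto (fun ε : ℝ≥0∞ => ε ^ (s - 1)) (nhdsWithin 0 (Set.Ioi 0)) (nhds 0) := by
      have := (ENNReal.continuous_rpow_const (y := s - 1)).tendsto 0
      rw [ENNReal.zero_rpow_of_pos (by linarith)] at this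
      exact this.mono_left nhdsWithin_le_nhds
    exact ENNReal.Tendsto.mul_const (ENNReal.Tendsto.const_mul h (.inr hC)) (.inr hAf)
  rw [mul_zero, zero_mul] at lim
  refine le_antisymm (ge_of_tendsto lim ?_) zero_le
  filter_upwards [self_mem_nhdsWithin] with ε hε using key ε hε

/-- If `μ`, `ν` are diffuse Radon measures on locally compact
Hausdorff spaces and `p, q ∈ (0,∞)` with `min(p,q) < 1`, then every continuous linear
functional on `L^{p,q}(μ,ν)` vanishes. -/
theorem stmt_13 {X Y : Type*}
    [TopologicalSpace X] [LocallyCompactSpace X] [T2Space X]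
    [MeasurableSpace X] [BorelSpace X]
    [TopologicalSpace Y] [LocallyCompactSpace Y] [T2Space Y]
    [MeasurableSpace Y] [BorelSpace Y]
    (μ : Measure X) (ν : Measure Y) [μ.Regular] [ν.Regular]
    [SigmaFinite μ] [SigmaFinite ν]
    (hμd : ∀ x : X, μ {x} = 0) (hνd : ∀ y : Y, ν {y} = 0)
    (p q : ℝ≥0∞) (hp : 0 < p) (hpf : p ≠ ⊤) (hq : 0 < q) (hqf : q ≠ ⊤)
    (hmin : min p q < 1)
    (L : (X × Y → ℂ) → ℂ)
    (hadd : ∀ f g : X × Y → ℂ,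
      AEStronglyMeasurable f (μ.prod ν) → mixedNorm p q μ ν f < ⊤ →
      AEStronglyMeasurable g (μ.prod ν) → mixedNorm p q μ ν g < ⊤ →
      L (f + g) = L f + L g)
    (hsmul : ∀ (c : ℂ) (f : X × Y → ℂ),
      AEStronglyMeasurable f (μ.prod ν) → mixedNorm p q μ ν f < ⊤ →
      L (c • f) = c * L f)
    (hae : ∀ f g : X × Y → ℂ, f =ᵐ[μ.prod ν] g → L f = L g)
    (hcont : ∀ ε : ℝ, 0 < ε → ∃ δ : ℝ, 0 < δ ∧
      ∀ f : X × Y → ℂ, AEStronglyMeasurable f (μ.prod ν) →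
        mixedNorm p q μ ν f < ENNReal.ofReal δ → ‖L f‖ < ε) :
    ∀ f : X × Y → ℂ, AEStronglyMeasurable f (μ.prod ν) →
      mixedNorm p q μ ν f < ⊤ → L f = 0 := by
  have hL : ∃ C : ℝ≥0∞, C ≠ ⊤ ∧ ∀ f : X × Y → ℂ, AEStronglyMeasurable f (μ.prod ν) →
      mixedNorm p q μ ν f < ⊤ → ‖L f‖ₑ ≤ C * mixedNorm p q μ ν f := by
    obtain ⟨δ, hδ, h⟩ := hcont 1 one_pos
    refine ⟨(ENNReal.ofReal δ)⁻¹, by simpa using hδ, fun f hf hfin => ?_⟩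
    have hδ0 : ENNReal.ofReal δ ≠ 0 := by simpa using hδ
    rw [mul_comm, ← div_eq_mul_inv,
      ENNReal.le_div_iff_mul_le (.inl hδ0) (.inl ENNReal.ofReal_ne_top)]
    refine le_of_forall_gt_imp_ge_of_dense fun t ht => ?_
    rcases eq_or_ne t ⊤ with rfl | htop
    · exact le_top
    have ht0 : 0 < t.toReal := ENNReal.toReal_pos (pos_of_gt ht).ne' htop
    have hc : ‖((δ / t.toReal : ℝ) : ℂ)‖ₑ = ENNReal.ofReal δ / t := by
      rw [← ofReal_norm, Complex.norm_real, Real.norm_of_nonneg (by positivity),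
        ENNReal.ofReal_div_of_pos ht0, ENNReal.ofReal_toReal htop]
    have hlt := h (((δ / t.toReal : ℝ) : ℂ) • f) (hf.const_smul _) (by
      rw [mixedNorm.const_smul hq hqf, hc, ENNReal.div_eq_inv_mul, mul_right_comm,
        ← ENNReal.div_eq_inv_mul]
      nth_rewrite 2 [← one_mul (ENNReal.ofReal δ)]
      refine ENNReal.mul_lt_mul_left hδ0 ENNReal.ofReal_ne_top ?_
      exact ENNReal.div_lt_of_lt_mul (by simpa using ht))
    rw [hsmul _ f hf hfin, norm_mul, Complex.norm_real, Real.norm_of_nonneg (by positivity),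
      div_mul_eq_mul_div, div_lt_one ht0] at hlt
    rw [← ENNReal.ofReal_toReal htop, ← ofReal_norm,
      ← ENNReal.ofReal_mul (norm_nonneg _), mul_comm]
    exact ENNReal.ofReal_le_ofReal hlt.le
  obtain ⟨C, hC, hL⟩ := hL
  have hind (f : X × Y → ℂ) (hf : Measurable f) (hfin : mixedNorm p q μ ν f < ⊤)
      (D : Set (X × Y)) (hD : MeasurableSet D) :
      AEStronglyMeasurable (D.indicator f) (μ.prod ν) ∧ mixedNorm p q μ ν (D.indicator f) < ⊤ :=
    ⟨(hf.indicator hD).aestronglyMeasurable,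
      (mixedNorm.mono hqf μ ν fun z => enorm_indicator_le_enorm_self f z).trans_lt hfin⟩
  have hunion (f : X × Y → ℂ) (hf : Measurable f) (hfin : mixedNorm p q μ ν f < ⊤)
      (D E : Set (X × Y)) (hD : MeasurableSet D) (hE : MeasurableSet E) (hDE : Disjoint D E) :
      ‖L ((D ∪ E).indicator f)‖ₑ ≤ ‖L (D.indicator f)‖ₑ + ‖L (E.indicator f)‖ₑ := by
    have h : (D ∪ E).indicator f = D.indicator f + E.indicator f :=
      Set.indicator_union_of_disjoint hDE f
    obtain ⟨h₁, h₂⟩ := hind f hf hfin D hD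
    obtain ⟨h₃, h₄⟩ := hind f hf hfin E hE
    rw [h, hadd _ _ h₁ h₂ h₃ h₄]
    exact enorm_add_le _ _
  have hp' : 0 < p.toReal := ENNReal.toReal_pos hp.ne' hpf
  have hq' : 0 < q.toReal := ENNReal.toReal_pos hq.ne' hqf
  have hbdd (f : X × Y → ℂ) (hf : Measurable f) (M : ℝ≥0∞) (hM : M ≠ ⊤)
      (hfM : ∀ z, ‖f z‖ₑ ≤ M) (A : Set X) (B : Set Y) (hA : MeasurableSet A)
      (hB : MeasurableSet B) (hAf : μ A ≠ ⊤) (hBf : ν B ≠ ⊤)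
      (hfAB : ∀ z, z ∉ A ×ˢ B → f z = 0) : L f = 0 := by
    have hμA : μ A ^ (1 / p.toReal) ≠ ⊤ := ENNReal.rpow_ne_top_of_nonneg (by positivity) hAf
    have hνB : ν B ^ (1 / q.toReal) ≠ ⊤ := ENNReal.rpow_ne_top_of_nonneg (by positivity) hBf
    have hfin : mixedNorm p q μ ν f < ⊤ :=
      (mixedNorm.le_of_bounded_of_support_subset hp hpf hq hqf μ ν hA hB hfM hfAB).trans_lt
        (by finiteness)
    rw [← enorm_eq_zero]
    have hMi (D : Set (X × Y)) (z : X × Y) : ‖D.indicator f z‖ₑ ≤ M :=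
      (enorm_indicator_le_enorm_self f z).trans (hfM z)
    rcases min_lt_iff.mp hmin with hp1 | hq1
    · have hs : 1 < 1 / p.toReal :=
        one_lt_one_div hp' (by simpa using ENNReal.toReal_strict_mono ENNReal.one_ne_top hp1)
      have h := eq_zero_of_le_measure_rpow μ hμd
        (fun S => ‖L ((S ×ˢ Set.univ).indicator f)‖ₑ) (C * M * ν B ^ (1 / q.toReal))
        (by finiteness) hs (fun S hS => ?_) (fun S T hS hT hST => ?_) hA hAf
      · rwa [Set.indicator_eq_self.mpr] at h
        intro z hz
        by_contra hzA
        exact hz (hfAB z fun hz' => hzA ⟨hz'.1, trivial⟩)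
      · have hD : MeasurableSet (S ×ˢ (Set.univ : Set Y)) := hS.prod .univ
        obtain ⟨h₁, h₂⟩ := hind f hf hfin _ hD
        refine (hL _ h₁ h₂).trans ?_
        calc _ ≤ C * (M * μ S ^ (1 / p.toReal) * ν B ^ (1 / q.toReal)) := by
              gcongr
              refine mixedNorm.le_of_bounded_of_support_subset hp hpf hq hqf μ ν hS hB (hMi _) ?_
              intro z hz
              rw [Set.indicator_apply_eq_zero]
              exact fun hzS => hfAB z fun hz' => hz ⟨hzS.1, hz'.2⟩
          _ = _ := by ring
      · rw [Set.union_prod]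
        exact hunion f hf hfin _ _ (hS.prod .univ) (hT.prod .univ)
          (Set.disjoint_prod.mpr (.inl hST))
    · have hs : 1 < 1 / q.toReal :=
        one_lt_one_div hq' (by simpa using ENNReal.toReal_strict_mono ENNReal.one_ne_top hq1)
      have h := eq_zero_of_le_measure_rpow ν hνd
        (fun S => ‖L ((Set.univ ×ˢ S).indicator f)‖ₑ) (C * M * μ A ^ (1 / p.toReal))
        (by finiteness) hs (fun S hS => ?_) (fun S T hS hT hST => ?_) hB hBf
      · rwa [Set.indicator_eq_self.mpr] at h
        intro z hz
        by_contra hzB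
        exact hz (hfAB z fun hz' => hzB ⟨trivial, hz'.2⟩)
      · have hD : MeasurableSet ((Set.univ : Set X) ×ˢ S) := MeasurableSet.univ.prod hS
        obtain ⟨h₁, h₂⟩ := hind f hf hfin _ hD
        refine (hL _ h₁ h₂).trans ?_
        calc _ ≤ C * (M * μ A ^ (1 / p.toReal) * ν S ^ (1 / q.toReal)) := by
              gcongr
              refine mixedNorm.le_of_bounded_of_support_subset hp hpf hq hqf μ ν hA hS (hMi _) ?_
              intro z hz
              rw [Set.indicator_apply_eq_zero]
              exact fun hzS => hfAB z fun hz' => hz ⟨hz'.1, hzS.2⟩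
          _ = _ := by ring
      · rw [Set.prod_union]
        exact hunion f hf hfin _ _ (MeasurableSet.univ.prod hS) (MeasurableSet.univ.prod hT)
          (Set.disjoint_prod.mpr (.inr hST))
  have hmeas (f : X × Y → ℂ) (hf : Measurable f) (hfin : mixedNorm p q μ ν f < ⊤) : L f = 0 := by
    set E : ℕ → Set (X × Y) := fun n =>
      {z | ‖f z‖ ≤ n} ∩ spanningSets μ n ×ˢ spanningSets ν n
    have hE (n : ℕ) : MeasurableSet (E n) :=
      (measurableSet_le hf.norm measurable_const).inter
        ((measurableSet_spanningSets μ n).prod (measurableSet_spanningSets ν n))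
    have hE0 (n : ℕ) : L ((E n).indicator f) = 0 := by
      refine hbdd _ (hf.indicator (hE n)) n (ENNReal.natCast_ne_top n) (fun z => ?_)
        (spanningSets μ n) (spanningSets ν n) (measurableSet_spanningSets μ n)
        (measurableSet_spanningSets ν n) (measure_spanningSets_lt_top μ n).ne
        (measure_spanningSets_lt_top ν n).ne fun z hz => ?_
      · by_cases hz : z ∈ E n
        · rw [Set.indicator_of_mem hz, ← ofReal_norm, ← ENNReal.ofReal_natCast]
          exact ENNReal.ofReal_le_ofReal hz.1
        · simp [hz]
      · exact Set.indicator_of_notMem (fun hz' => hz hz'.2) f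
    have hlim := mixedNorm.tendsto_indicator_zero hp hpf hq hqf μ ν hf hfin
      (fun n => (hE n).compl) (fun z => by
        filter_upwards [eventually_ge_atTop ⌈‖f z‖⌉₊,
          eventually_ge_atTop (spanningSetsIndex μ z.1),
          eventually_ge_atTop (spanningSetsIndex ν z.2)] with n h₁ h₂ h₃
        exact fun h => h ⟨Nat.ceil_le.mp h₁, mem_spanningSets_of_index_le μ z.1 h₂,
          mem_spanningSets_of_index_le ν z.2 h₃⟩)
    have hlim' := ENNReal.Tendsto.const_mul hlim (.inr hC)
    rw [mul_zero] at hlim'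
    rw [← enorm_eq_zero]
    refine le_antisymm (ge_of_tendsto' hlim' fun n => ?_) zero_le
    have h := hunion f hf hfin (E n) (E n)ᶜ (hE n) (hE n).compl disjoint_compl_right
    rw [Set.union_compl_self, Set.indicator_univ, hE0 n, enorm_zero, zero_add] at h
    obtain ⟨h₁, h₂⟩ := hind f hf hfin _ (hE n).compl
    exact h.trans (hL _ h₁ h₂)
  intro f hf hfin
  rw [hae _ _ hf.ae_eq_mk]
  refine hmeas _ hf.stronglyMeasurable_mk.measurable ?_
  rwa [← mixedNorm.congr_ae hqf μ ν hf.ae_eq_mk]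
end
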